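/- arXiv:math-ph/0505053 — 2 statements merged into one kernel-verified Lean document; each statement's English description precedes it below -/
import Mathlib

section
/- For every m >= 2, every j >= 1, and every 1 <= n <= 2^{m-2}, the ratio of the j-th descendant odd interval to its parent even interval satisfies the bounds 2(2j+3)/(3(j+1)(j+2)) <= I_{m+j}^(2^j(2n-1)+1) / I_m^(2n) <= 3/(2j+3). -/
/-- Numerators of the modified Farey sequence: at level `k`, order `n` (1-indexed,
`n = 1, …, 2^k + 1`). Level 0 is `0/1, 1/1`; odd orders at level `k+1` are carried
over from level `k`, even orders are mediants. -/
def fareyNum : ℕ → ℕ → ℕ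
  | 0, n => if n = 1 then 0 else 1
  | k + 1, m =>
      if m % 2 = 1 then fareyNum k ((m + 1) / 2)
      else fareyNum k (m / 2) + fareyNum k (m / 2 + 1)

/-- Denominators of the modified Farey sequence. -/
def fareyDen : ℕ → ℕ → ℕ
  | 0, _ => 1
  | k + 1, m =>
      if m % 2 = 1 then fareyDen k ((m + 1) / 2)
      else fareyDen k (m / 2) + fareyDen k (m / 2 + 1)

/-- The Farey fraction `r_k^(n) = n_k^(n) / d_k^(n)` as a real number. -/
noncomputable def fareyR (k n : ℕ) : ℝ := (fareyNum k n : ℝ) / (fareyDen k n : ℝ)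

/-- The interval `I_k^(n)`: for `n ≥ 2` it is `r_k^(2n) - r_k^(2n-2)`, and
`I_k^(1) := 2/(k+1)`. -/
noncomputable def fareyI (k n : ℕ) : ℝ :=
  if n = 1 then 2 / ((k : ℝ) + 1) else fareyR k (2 * n) - fareyR k (2 * n - 2)

/-- Total length of even intervals at level `k`. -/
noncomputable def fareyIe (k : ℕ) : ℝ :=
  ∑ i ∈ Finset.Icc 1 (2 ^ (k - 2)), fareyI k (2 * i)

/-- Total length of odd intervals at level `k`. -/
noncomputable def fareyIo (k : ℕ) : ℝ :=
  ∑ i ∈ Finset.Icc 1 (2 ^ (k - 2)), fareyI k (2 * i - 1)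

/-- `S_k`: the sum of inverse squares of the new denominators at level `k`. -/
noncomputable def fareyS (k : ℕ) : ℝ :=
  ∑ n ∈ Finset.Icc 1 (2 ^ (k - 1)), 1 / (fareyDen k (2 * n) : ℝ) ^ 2

theorem fareyNum_succ_odd (k p : ℕ) : fareyNum (k + 1) (2 * p + 1) = fareyNum k (p + 1) := by
  have h : (2 * p + 1) % 2 = 1 := by omega
  have h' : (2 * p + 1 + 1) / 2 = p + 1 := by omega
  rw [fareyNum, if_pos h, h']

theorem fareyNum_succ_even (k p : ℕ) :
    fareyNum (k + 1) (2 * p) = fareyNum k p + fareyNum k (p + 1) := by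
  have h : ¬ (2 * p) % 2 = 1 := by omega
  have h' : 2 * p / 2 = p := by omega
  rw [fareyNum, if_neg h, h']

theorem fareyDen_succ_odd (k p : ℕ) : fareyDen (k + 1) (2 * p + 1) = fareyDen k (p + 1) := by
  have h : (2 * p + 1) % 2 = 1 := by omega
  have h' : (2 * p + 1 + 1) / 2 = p + 1 := by omega
  rw [fareyDen, if_pos h, h']

theorem fareyDen_succ_even (k p : ℕ) :
    fareyDen (k + 1) (2 * p) = fareyDen k p + fareyDen k (p + 1) := by
  have h : ¬ (2 * p) % 2 = 1 := by omega
  have h' : 2 * p / 2 = p := by omega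
  rw [fareyDen, if_neg h, h']

theorem fareyDen_pos (k n : ℕ) : 0 < fareyDen k n := by
  induction k generalizing n with
  | zero => simp [fareyDen]
  | succ k ih =>
    rw [fareyDen]
    split_ifs
    · exact ih _
    · exact Nat.add_pos_left (ih _) _

/-- Consecutive Farey fractions are unimodular. -/
theorem fareyNum_mul_fareyDen_succ (k p : ℕ) (hp : p < 2 ^ k) :
    fareyNum k (p + 2) * fareyDen k (p + 1) = fareyNum k (p + 1) * fareyDen k (p + 2) + 1 := by
  induction k generalizing p with
  | zero =>
    obtain rfl : p = 0 := by simpa using hp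
    simp [fareyNum, fareyDen]
  | succ k ih =>
    rw [pow_succ] at hp
    obtain ⟨r, rfl | rfl⟩ := Nat.even_or_odd' p
    · have h := ih r (by omega)
      rw [show 2 * r + 2 = 2 * (r + 1) by ring, fareyNum_succ_even, fareyNum_succ_odd,
        fareyDen_succ_even, fareyDen_succ_odd]
      linear_combination h
    · have h := ih r (by omega)
      rw [show 2 * r + 1 + 2 = 2 * (r + 1) + 1 by ring, show 2 * r + 1 + 1 = 2 * (r + 1) by ring,
        fareyNum_succ_even, fareyNum_succ_odd, fareyDen_succ_even, fareyDen_succ_odd]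
      linear_combination h

/-- In a sequence of levels refined by inserting sums of neighbours, an entry persists, and its
two neighbours `s` levels later have gained `s` copies of it. -/
theorem mediant_refinement_neighbours {f : ℕ → ℕ → ℕ}
    (hodd : ∀ k p, f (k + 1) (2 * p + 1) = f k (p + 1))
    (heven : ∀ k p, f (k + 1) (2 * p) = f k p + f k (p + 1)) (k q s : ℕ) :
    f (k + s) (2 ^ s * q) = f k q + s * f k (q + 1) ∧
      f (k + s) (2 ^ s * q + 1) = f k (q + 1) ∧
      f (k + s) (2 ^ s * q + 2) = f k (q + 2) + s * f k (q + 1) := by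
  induction s with
  | zero => simp
  | succ s ih =>
    obtain ⟨hl, hc, hr⟩ := ih
    rw [← add_assoc, show 2 ^ (s + 1) * q = 2 * (2 ^ s * q) by ring,
      show 2 * (2 ^ s * q) + 2 = 2 * (2 ^ s * q + 1) by ring, heven, hodd, heven, hl, hc, hr]
    refine ⟨?_, rfl, ?_⟩ <;> ring

theorem fareyI_descendant (k j p : ℕ) (hp : p < 2 ^ k) :
    fareyI (k + 2 + j) (2 ^ j * (2 * p + 1) + 1) =
      (2 * (j : ℝ) + 3) /
        ((fareyDen k (p + 1) + (j + 1) * (fareyDen k (p + 1) + fareyDen k (p + 2))) *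
          (fareyDen k (p + 2) + (j + 1) * (fareyDen k (p + 1) + fareyDen k (p + 2)))) := by
  have hne : 2 ^ j * (2 * p + 1) + 1 ≠ 1 := by simp
  have hr : 2 * (2 ^ j * (2 * p + 1) + 1) = 2 ^ (j + 1) * (2 * p + 1) + 2 := by ring
  have hmid : 2 * p + 1 + 1 = 2 * (p + 1) := by ring
  have hright : 2 * p + 1 + 2 = 2 * (p + 1) + 1 := by ring
  obtain ⟨hn, -, hn'⟩ := mediant_refinement_neighbours fareyNum_succ_odd fareyNum_succ_even
    (k + 1) (2 * p + 1) (j + 1)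
  obtain ⟨hd, -, hd'⟩ := mediant_refinement_neighbours fareyDen_succ_odd fareyDen_succ_even
    (k + 1) (2 * p + 1) (j + 1)
  rw [fareyNum_succ_odd, hmid, fareyNum_succ_even] at hn
  rw [hright, fareyNum_succ_odd, hmid, fareyNum_succ_even] at hn'
  rw [fareyDen_succ_odd, hmid, fareyDen_succ_even] at hd
  rw [hright, fareyDen_succ_odd, hmid, fareyDen_succ_even] at hd'
  rw [fareyI, if_neg hne, hr, Nat.add_sub_cancel, show k + 2 + j = k + 1 + (j + 1) by ring,
    fareyR, fareyR, hn, hn', hd, hd']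
  have hdet := fareyNum_mul_fareyDen_succ k p hp
  have hb := fareyDen_pos k (p + 1)
  have he := fareyDen_pos k (p + 2)
  simp only [add_assoc, Nat.reduceAdd]
  generalize fareyNum k (p + 1) = a at *
  generalize fareyDen k (p + 1) = b at *
  generalize fareyNum k (p + 2) = c at *
  generalize fareyDen k (p + 2) = d at *
  have hdet' : (c : ℝ) * b = a * d + 1 := by exact_mod_cast hdet
  have hb' : (0 : ℝ) < b := by exact_mod_cast hb
  have he' : (0 : ℝ) < d := by exact_mod_cast he
  push_cast
  rw [div_sub_div _ _ (by positivity) (by positivity), div_eq_div_iff (by positivity)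
    (by positivity)]
  linear_combination (2 * (j : ℝ) + 3) * (b + (j + 1) * (b + d)) * (d + (j + 1) * (b + d)) * hdet'

/-- Bounds on the ratio of the `j`-th descendant odd interval to its parent
even interval. -/
theorem farey_interval_ratio_bounds (m j n : ℕ) (hm : 2 ≤ m) (hj : 1 ≤ j)
    (h1 : 1 ≤ n) (h2 : n ≤ 2 ^ (m - 2)) :
    2 * (2 * (j : ℝ) + 3) / (3 * ((j : ℝ) + 1) * ((j : ℝ) + 2)) ≤
        fareyI (m + j) (2 ^ j * (2 * n - 1) + 1) / fareyI m (2 * n) ∧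
      fareyI (m + j) (2 ^ j * (2 * n - 1) + 1) / fareyI m (2 * n) ≤
        3 / (2 * (j : ℝ) + 3) := by
  obtain ⟨k, rfl⟩ := Nat.exists_eq_add_of_le' hm
  obtain ⟨p, rfl⟩ := Nat.exists_eq_add_of_le' h1
  rw [Nat.add_sub_cancel] at h2
  have hparent := fareyI_descendant k 0 p h2
  rw [add_zero, pow_zero, one_mul, show 2 * p + 1 + 1 = 2 * (p + 1) by ring] at hparent
  rw [show 2 * (p + 1) - 1 = 2 * p + 1 by omega, fareyI_descendant k j p h2, hparent]
  have hb : (0 : ℝ) < fareyDen k (p + 1) := by exact_mod_cast fareyDen_pos k (p + 1)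
  have hd : (0 : ℝ) < fareyDen k (p + 2) := by exact_mod_cast fareyDen_pos k (p + 2)
  generalize (fareyDen k (p + 1) : ℝ) = b at *
  generalize (fareyDen k (p + 2) : ℝ) = d at *
  have hj0 : (0 : ℝ) ≤ j := Nat.cast_nonneg j
  generalize (j : ℝ) = x at *
  have hratio : (2 * x + 3) / ((b + (x + 1) * (b + d)) * (d + (x + 1) * (b + d))) /
      ((2 * ((0 : ℕ) : ℝ) + 3) / ((b + (((0 : ℕ) : ℝ) + 1) * (b + d)) *
        (d + (((0 : ℕ) : ℝ) + 1) * (b + d)))) =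
      (2 * x + 3) * (2 * (b + d) ^ 2 + b * d) /
        (3 * ((x + 1) * (x + 2) * (b + d) ^ 2 + b * d)) := by
    rw [div_div_div_eq]
    congr 1 <;> push_cast <;> ring
  have hprod : 0 < b * d := mul_pos hb hd
  rw [hratio]
  constructor
  · rw [div_le_div_iff₀ (by positivity) (by positivity), ← sub_nonneg]
    have : 0 ≤ 3 * (2 * x + 3) * (b * d) * (x * (x + 3)) := by positivity
    linear_combination this
  · rw [div_le_div_iff₀ (by positivity) (by positivity), ← sub_nonneg]
    have : 0 ≤ x * (x + 3) * (b - d) ^ 2 := by positivity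
    linear_combination this
end

section
/- For every level k >= 2, the double inequality S_k < I_k^(e) < 4 * S_{k-1} holds. -/
theorem fareyNum_succ_two_mul (k n : ℕ) :
    fareyNum (k + 1) (2 * n) = fareyNum k n + fareyNum k (n + 1) := by
  simp [fareyNum]

theorem fareyNum_succ_two_mul_add_one (k n : ℕ) :
    fareyNum (k + 1) (2 * n + 1) = fareyNum k (n + 1) := by
  have h : (2 * n + 1 + 1) / 2 = n + 1 := by omega
  have h' : (2 * n + 1) % 2 = 1 := by omega
  simp only [fareyNum, h, h', if_true]

theorem fareyDen_succ_two_mul (k n : ℕ) :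
    fareyDen (k + 1) (2 * n) = fareyDen k n + fareyDen k (n + 1) := by
  simp [fareyDen]

theorem fareyDen_succ_two_mul_add_one (k n : ℕ) :
    fareyDen (k + 1) (2 * n + 1) = fareyDen k (n + 1) := by
  have h : (2 * n + 1 + 1) / 2 = n + 1 := by omega
  have h' : (2 * n + 1) % 2 = 1 := by omega
  simp only [fareyDen, h, h', if_true]

/-- Consecutive Farey fractions are unimodular. -/
theorem fareyNum_succ_mul_fareyDen (k n : ℕ) (h1 : 1 ≤ n) (h2 : n ≤ 2 ^ k) :
    fareyNum k (n + 1) * fareyDen k n = fareyNum k n * fareyDen k (n + 1) + 1 := by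
  induction k generalizing n with
  | zero =>
    obtain rfl : n = 1 := by simp at h2; omega
    simp [fareyNum, fareyDen]
  | succ k ih =>
    rw [pow_succ] at h2
    obtain ⟨m, rfl | rfl⟩ := Nat.even_or_odd' n
    · rw [fareyNum_succ_two_mul, fareyNum_succ_two_mul_add_one, fareyDen_succ_two_mul,
        fareyDen_succ_two_mul_add_one]
      linarith [ih m (by omega) (by omega)]
    · rw [show 2 * m + 1 + 1 = 2 * (m + 1) by ring, fareyNum_succ_two_mul,
        fareyNum_succ_two_mul_add_one, fareyDen_succ_two_mul, fareyDen_succ_two_mul_add_one]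
      linarith [ih (m + 1) (by omega) (by omega)]

/-- The first new denominator inserted between the `i`-th and `i+1`-st fractions after two
refinements. -/
theorem fareyDen_add_two_left (k i : ℕ) (hi : 1 ≤ i) :
    fareyDen (k + 2) (2 * (2 * i - 1)) = 2 * fareyDen k i + fareyDen k (i + 1) := by
  obtain ⟨j, rfl⟩ := Nat.exists_eq_add_of_le' hi
  rw [show 2 * (j + 1) - 1 = 2 * j + 1 by omega, fareyDen_succ_two_mul,
    fareyDen_succ_two_mul_add_one, show 2 * j + 1 + 1 = 2 * (j + 1) by ring,
    fareyDen_succ_two_mul]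
  ring

theorem fareyNum_add_two_left (k i : ℕ) (hi : 1 ≤ i) :
    fareyNum (k + 2) (2 * (2 * i - 1)) = 2 * fareyNum k i + fareyNum k (i + 1) := by
  obtain ⟨j, rfl⟩ := Nat.exists_eq_add_of_le' hi
  rw [show 2 * (j + 1) - 1 = 2 * j + 1 by omega, fareyNum_succ_two_mul,
    fareyNum_succ_two_mul_add_one, show 2 * j + 1 + 1 = 2 * (j + 1) by ring,
    fareyNum_succ_two_mul]
  ring

/-- The last new denominator inserted between the `i`-th and `i+1`-st fractions after two
refinements. -/
theorem fareyDen_add_two_right (k i : ℕ) :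
    fareyDen (k + 2) (2 * (2 * i)) = fareyDen k i + 2 * fareyDen k (i + 1) := by
  rw [fareyDen_succ_two_mul, fareyDen_succ_two_mul_add_one, fareyDen_succ_two_mul]
  ring

theorem fareyNum_add_two_right (k i : ℕ) :
    fareyNum (k + 2) (2 * (2 * i)) = fareyNum k i + 2 * fareyNum k (i + 1) := by
  rw [fareyNum_succ_two_mul, fareyNum_succ_two_mul_add_one, fareyNum_succ_two_mul]
  ring

theorem fareyI_add_two_two_mul (k i : ℕ) (h1 : 1 ≤ i) (h2 : i ≤ 2 ^ k) :
    fareyI (k + 2) (2 * i) = 3 / ((2 * (fareyDen k i : ℝ) + fareyDen k (i + 1)) *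
      (fareyDen k i + 2 * (fareyDen k (i + 1) : ℝ))) := by
  have hp : (0 : ℝ) < fareyDen k i := by exact_mod_cast fareyDen_pos k i
  have hq : (0 : ℝ) < fareyDen k (i + 1) := by exact_mod_cast fareyDen_pos k (i + 1)
  have hdet : (fareyNum k (i + 1) : ℝ) * fareyDen k i =
      fareyNum k i * fareyDen k (i + 1) + 1 := by
    exact_mod_cast fareyNum_succ_mul_fareyDen k i h1 h2
  rw [fareyI, if_neg (by omega), show 2 * (2 * i) - 2 = 2 * (2 * i - 1) by omega, fareyR, fareyR,
    fareyDen_add_two_left k i h1, fareyNum_add_two_left k i h1, fareyDen_add_two_right,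
    fareyNum_add_two_right]
  push_cast
  rw [div_sub_div _ _ (by positivity) (by positivity)]
  congr 1
  · linear_combination 3 * hdet
  · ring

theorem sum_Icc_one_two_mul {M : Type*} [AddCommMonoid M] (f : ℕ → M) (N : ℕ) :
    ∑ n ∈ Finset.Icc 1 (2 * N), f n = ∑ i ∈ Finset.Icc 1 N, (f (2 * i - 1) + f (2 * i)) := by
  induction N with
  | zero => simp
  | succ N ih =>
    rw [show 2 * (N + 1) = 2 * N + 1 + 1 by ring, Finset.sum_Icc_succ_top (by omega),
      Finset.sum_Icc_succ_top (by omega), Finset.sum_Icc_succ_top (by omega), ih, add_assoc,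
      show 2 * (N + 1) = 2 * N + 1 + 1 by ring, Nat.add_sub_cancel]

/-- For `k ≥ 2`, `S_k < I_k^(e) < 4 S_{k-1}`. -/
theorem fareyS_lt_fareyIe_lt (k : ℕ) (hk : 2 ≤ k) :
    fareyS k < fareyIe k ∧ fareyIe k < 4 * fareyS (k - 1) := by
  obtain ⟨m, rfl⟩ := Nat.exists_eq_add_of_le' hk
  have hne : (Finset.Icc 1 (2 ^ m)).Nonempty := ⟨1, by simp [Nat.one_le_two_pow]⟩
  constructor
  · rw [fareyS, fareyIe, show m + 2 - 1 = m + 1 by omega, Nat.add_sub_cancel, pow_succ',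
      sum_Icc_one_two_mul]
    refine Finset.sum_lt_sum_of_nonempty hne fun i hi => ?_
    obtain ⟨h1, h2⟩ := Finset.mem_Icc.mp hi
    have hp : (0 : ℝ) < fareyDen m i := by exact_mod_cast fareyDen_pos m i
    have hq : (0 : ℝ) < fareyDen m (i + 1) := by exact_mod_cast fareyDen_pos m (i + 1)
    rw [fareyI_add_two_two_mul m i h1 h2, fareyDen_add_two_left m i h1, fareyDen_add_two_right]
    push_cast
    rw [div_add_div _ _ (by positivity) (by positivity),
      div_lt_div_iff₀ (by positivity) (by positivity)]
    generalize (fareyDen m i : ℝ) = p at *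
    generalize (fareyDen m (i + 1) : ℝ) = q at *
    have key : 0 < ((2 * p + q) * (p + 2 * q)) * (p ^ 2 + 7 * (p * q) + q ^ 2) := by positivity
    linarith [key]
  · rw [fareyS, fareyIe, show m + 2 - 1 - 1 = m by omega, show m + 2 - 1 = m + 1 by omega,
      Nat.add_sub_cancel, Finset.mul_sum]
    refine Finset.sum_lt_sum_of_nonempty hne fun i hi => ?_
    obtain ⟨h1, h2⟩ := Finset.mem_Icc.mp hi
    have hp : (0 : ℝ) < fareyDen m i := by exact_mod_cast fareyDen_pos m i
    have hq : (0 : ℝ) < fareyDen m (i + 1) := by exact_mod_cast fareyDen_pos m (i + 1)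
    rw [fareyI_add_two_two_mul m i h1 h2, fareyDen_succ_two_mul]
    push_cast
    rw [mul_one_div, div_lt_div_iff₀ (by positivity) (by positivity)]
    nlinarith [mul_pos hp hq, sq_nonneg (fareyDen m i : ℝ), pow_pos hp 2, pow_pos hq 2]
end
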